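/- arXiv:math/0503228 — 2 statements merged into one kernel-verified Lean document; each statement's English description precedes it below -/
import Mathlib

section
/- Let Γ = (R,S) be a finite binary relation. Then there exists a natural number N such that for all m ≥ N and n ≥ N, the iterated contraction C_l^m C_r^n Γ is graph-isomorphic to C_l^N C_r^N Γ. (This common value is called the C-stabilization C^{∞,∞}Γ of Γ.) -/
open Polynomial

namespace Towber

/-- A transformation-pair over `K`: two `K`-linear maps between
finite-dimensional `K`-vector spaces. -/
structure Pair (K : Type) [Field K] where
  E : Type
  V : Type
  [addE : AddCommGroup E]
  [modE : Module K E]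
  [finE : FiniteDimensional K E]
  [addV : AddCommGroup V]
  [modV : Module K V]
  [finV : FiniteDimensional K V]
  mu : E →ₗ[K] V
  nu : E →ₗ[K] V

attribute [instance] Pair.addE Pair.modE Pair.finE Pair.addV Pair.modV Pair.finV

variable (K : Type) [Field K]

/-- Isomorphism of transformation-pairs. -/
def Pair.Iso (τ σ : Pair K) : Prop :=
  ∃ (α : τ.E ≃ₗ[K] σ.E) (β : τ.V ≃ₗ[K] σ.V),
    (∀ x, σ.mu (α x) = β (τ.mu x)) ∧ (∀ x, σ.nu (α x) = β (τ.nu x))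

/-- Finite direct sum of transformation-pairs. -/
noncomputable def dSum (ι : Type) [Finite ι] (τ : ι → Pair K) : Pair K :=
  letI := Fintype.ofFinite ι
  { E := ∀ i, (τ i).E
    V := ∀ i, (τ i).V
    mu := LinearMap.pi fun i => (τ i).mu ∘ₗ LinearMap.proj i
    nu := LinearMap.pi fun i => (τ i).nu ∘ₗ LinearMap.proj i }

/-- Binary direct sum of transformation-pairs. -/
noncomputable def dSum2 (τ σ : Pair K) : Pair K where
  E := τ.E × σ.E
  V := τ.V × σ.V
  mu := τ.mu.prodMap σ.mu
  nu := τ.nu.prodMap σ.nu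

/-- A transformation-pair built from a pair of matrices. -/
noncomputable def ofMats {a b : ℕ} (M N : Matrix (Fin b) (Fin a) K) : Pair K where
  E := Fin a → K
  V := Fin b → K
  mu := Matrix.toLin' M
  nu := Matrix.toLin' N

/-- `^0T_n = [μ_n, I : K^n → K^n]`, where `μ_n` maps `f_i ↦ f_{i+1}`, `f_n ↦ 0`. -/
noncomputable def zT (n : ℕ) : Pair K :=
  ofMats K (Matrix.of fun j i : Fin n => if (i : ℕ) + 1 = (j : ℕ) then 1 else 0) 1

/-- `T^0_n = [I, μ_n : K^n → K^n]`. -/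
noncomputable def Tz (n : ℕ) : Pair K :=
  ofMats K 1 (Matrix.of fun j i : Fin n => if (i : ℕ) + 1 = (j : ℕ) then 1 else 0)

/-- `T_n = [κ_n, λ_n : K^n → K^{n+1}]`, `κ_n : f_i ↦ f_i`, `λ_n : f_i ↦ f_{i+1}`. -/
noncomputable def Tn (n : ℕ) : Pair K :=
  ofMats K (Matrix.of fun (j : Fin (n+1)) (i : Fin n) => if (j : ℕ) = (i : ℕ) then 1 else 0)
    (Matrix.of fun (j : Fin (n+1)) (i : Fin n) => if (j : ℕ) = (i : ℕ) + 1 then 1 else 0)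

/-- `^0T^0_n = [κ'_n, λ'_n : K^{n+1} → K^n]`. -/
noncomputable def zTz (n : ℕ) : Pair K :=
  ofMats K (Matrix.of fun (j : Fin n) (i : Fin (n+1)) => if (j : ℕ) = (i : ℕ) then 1 else 0)
    (Matrix.of fun (j : Fin n) (i : Fin (n+1)) => if (j : ℕ) + 1 = (i : ℕ) then 1 else 0)

/-- `S(F) = [·X, I : K[X]/(F) → K[X]/(F)]` for a nonzero polynomial `F`. -/
noncomputable def SP (F : Polynomial K) (hF : F ≠ 0) : Pair K :=
  letI : FiniteDimensional K (AdjoinRoot F) := (AdjoinRoot.powerBasis hF).finite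
  { E := AdjoinRoot F
    V := AdjoinRoot F
    mu := LinearMap.mulLeft K (AdjoinRoot.root F)
    nu := LinearMap.id }

/-- Membership in Kronecker's list `L(K)` (up to isomorphism). -/
def IsKron (σ : Pair K) : Prop :=
  (∃ n, 1 ≤ n ∧ Pair.Iso K σ (zT K n)) ∨
  (∃ n, 1 ≤ n ∧ Pair.Iso K σ (Tz K n)) ∨
  (∃ n, Pair.Iso K σ (Tn K n)) ∨
  (∃ n, Pair.Iso K σ (zTz K n)) ∨
  (∃ (p : Polynomial K) (n : ℕ), p.Monic ∧ Irreducible p ∧ p ≠ X ∧ 1 ≤ n ∧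
    ∃ h : p ^ n ≠ 0, Pair.Iso K σ (SP K (p ^ n) h))

/-- Being of type `S(p^n)` with `p` monic irreducible, `p ≠ X`, `n ≥ 1`. -/
def IsSType (σ : Pair K) : Prop :=
  ∃ (p : Polynomial K) (n : ℕ), p.Monic ∧ Irreducible p ∧ p ≠ X ∧ 1 ≤ n ∧
    ∃ h : p ^ n ≠ 0, Pair.Iso K σ (SP K (p ^ n) h)

/-- Membership in Weierstrass' (regular) part of Kronecker's list. -/
def IsKronReg (σ : Pair K) : Prop :=
  (∃ n, 1 ≤ n ∧ Pair.Iso K σ (zT K n)) ∨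
  (∃ n, 1 ≤ n ∧ Pair.Iso K σ (Tz K n)) ∨
  (∃ (p : Polynomial K) (n : ℕ), p.Monic ∧ Irreducible p ∧ p ≠ X ∧ 1 ≤ n ∧
    ∃ h : p ^ n ≠ 0, Pair.Iso K σ (SP K (p ^ n) h))

/-- A finite binary relation `(R, S)`. -/
structure BRel where
  S : Type
  R : S → S → Prop
  [fin : Finite S]

attribute [instance] BRel.fin

/-- The generating relation for left contraction:
`y ~ y'` whenever `∃ x, xRy ∧ xRy'`. -/
def BRel.lgen (Γ : BRel) : Γ.S → Γ.S → Prop := fun y y' => ∃ x, Γ.R x y ∧ Γ.R x y'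

/-- The generating relation for right contraction:
`x ~ x'` whenever `∃ y, xRy ∧ x'Ry`. -/
def BRel.rgen (Γ : BRel) : Γ.S → Γ.S → Prop := fun x x' => ∃ y, Γ.R x y ∧ Γ.R x' y

/-- Quotient of a binary relation by (the equivalence relation generated by) `r`:
two classes are related iff some representatives are related. -/
def BRel.quotBy (Γ : BRel) (r : Γ.S → Γ.S → Prop) : BRel where
  S := Quot r
  R := fun α β => ∃ a b, Quot.mk r a = α ∧ Quot.mk r b = β ∧ Γ.R a b

/-- Left contraction `C_l Γ`. -/
def BRel.Cl (Γ : BRel) : BRel := Γ.quotBy Γ.lgen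

/-- Right contraction `C_r Γ`. -/
def BRel.Cr (Γ : BRel) : BRel := Γ.quotBy Γ.rgen

/-- Graph-isomorphism of binary relations. -/
def BRel.Iso (Γ Δ : BRel) : Prop :=
  ∃ φ : Γ.S ≃ Δ.S, ∀ a b, Δ.R (φ a) (φ b) ↔ Γ.R a b

/-- `γ_{m,n}(Γ)`, the number of vertices of `C_l^m C_r^n Γ`. -/
noncomputable def BRel.gamma (Γ : BRel) (m n : ℕ) : ℕ :=
  Nat.card ((BRel.Cl^[m] (BRel.Cr^[n] Γ)).S)

/-- `Γ` has stabilized at `N`: for all `m, n ≥ N` the iterated contraction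
`C_l^m C_r^n Γ` is graph-isomorphic to `C_l^N C_r^N Γ`. -/
def BRel.StabAt (Γ : BRel) (N : ℕ) : Prop :=
  ∀ m, N ≤ m → ∀ n, N ≤ n →
    BRel.Iso (BRel.Cl^[m] (BRel.Cr^[n] Γ)) (BRel.Cl^[N] (BRel.Cr^[N] Γ))

/-- Number of edges of a binary relation. -/
noncomputable def BRel.edges (Γ : BRel) : ℕ :=
  Nat.card {p : Γ.S × Γ.S // Γ.R p.1 p.2}

/-- The `K`-linearization of a finite binary relation. -/
noncomputable def BRel.linz (Γ : BRel) : Pair K :=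
  letI := Fintype.ofFinite Γ.S
  letI := Classical.decEq Γ.S
  letI : DecidablePred (fun p : Γ.S × Γ.S => Γ.R p.1 p.2) := Classical.decPred _
  { E := {p : Γ.S × Γ.S // Γ.R p.1 p.2} → K
    V := Γ.S → K
    mu := Matrix.toLin' (Matrix.of fun (v : Γ.S) (e : {p : Γ.S × Γ.S // Γ.R p.1 p.2}) =>
      if e.1.1 = v then 1 else 0)
    nu := Matrix.toLin' (Matrix.of fun (v : Γ.S) (e : {p : Γ.S × Γ.S // Γ.R p.1 p.2}) =>
      if e.1.2 = v then 1 else 0) }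

/-- The disjoint union of the paths `L_{m i}` (on `m i` vertices) and the
cycles `C_{c j}` (on `c j` vertices). -/
def modelGraph (p q : ℕ) (m : Fin p → ℕ) (c : Fin q → ℕ) : BRel where
  S := (Σ i, Fin (m i)) ⊕ (Σ j, Fin (c j))
  R := fun x y =>
    (∃ (i : Fin p) (a b : Fin (m i)),
        x = Sum.inl ⟨i, a⟩ ∧ y = Sum.inl ⟨i, b⟩ ∧ (b : ℕ) = (a : ℕ) + 1) ∨
    (∃ (j : Fin q) (a b : Fin (c j)),
        x = Sum.inr ⟨j, a⟩ ∧ y = Sum.inr ⟨j, b⟩ ∧ (b : ℕ) = ((a : ℕ) + 1) % (c j))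

/-- A finite directed graph, possibly with parallel edges. -/
structure DiGraph where
  E : Type
  V : Type
  [finE : Finite E]
  [finV : Finite V]
  init : E → V
  term : E → V

attribute [instance] DiGraph.finE DiGraph.finV

/-- The parallelism relation on the edges of a directed graph. -/
def DiGraph.par (G : DiGraph) : G.E → G.E → Prop :=
  fun e e' => G.init e = G.init e' ∧ G.term e = G.term e'

/-- The reduced form of a directed graph: edges are parallelism classes. -/
def DiGraph.red (G : DiGraph) : DiGraph where
  E := Quot G.par
  V := G.V
  init := Quot.lift G.init fun _ _ h => h.1
  term := Quot.lift G.term fun _ _ h => h.2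

/-- The `K`-linearization of a finite directed graph. -/
noncomputable def DiGraph.linz (G : DiGraph) : Pair K :=
  letI := Fintype.ofFinite G.E
  letI := Fintype.ofFinite G.V
  letI := Classical.decEq G.V
  letI := Classical.decEq G.E
  { E := G.E → K
    V := G.V → K
    mu := Matrix.toLin' (Matrix.of fun (v : G.V) (e : G.E) => if G.init e = v then 1 else 0)
    nu := Matrix.toLin' (Matrix.of fun (v : G.V) (e : G.E) => if G.term e = v then 1 else 0) }

theorem BRel.Iso.refl (Γ : BRel) : Γ.Iso Γ := ⟨Equiv.refl _, fun _ _ => Iff.rfl⟩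

theorem BRel.Iso.symm {Γ Δ : BRel} : Γ.Iso Δ → Δ.Iso Γ := by
  rintro ⟨φ, h⟩
  exact ⟨φ.symm, fun a b => by rw [← h]; simp⟩

theorem BRel.Iso.trans {Γ Δ Θ : BRel} : Γ.Iso Δ → Δ.Iso Θ → Γ.Iso Θ := by
  rintro ⟨φ, h⟩ ⟨ψ, k⟩
  exact ⟨φ.trans ψ, fun a b => by simp [h, k]⟩

theorem BRel.Iso.natCard_eq {Γ Δ : BRel} : Γ.Iso Δ → Nat.card Γ.S = Nat.card Δ.S := by
  rintro ⟨φ, _⟩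
  exact Nat.card_congr φ

/-- An isomorphism matching the generating relations descends to the quotients. -/
theorem BRel.quotBy_iso {Γ Δ : BRel} (φ : Γ.S ≃ Δ.S) (h : ∀ a b, Δ.R (φ a) (φ b) ↔ Γ.R a b)
    {r : Γ.S → Γ.S → Prop} {s : Δ.S → Δ.S → Prop} (hrs : ∀ a b, r a b ↔ s (φ a) (φ b)) :
    (Γ.quotBy r).Iso (Δ.quotBy s) := by
  refine ⟨Quot.congr φ hrs, ?_⟩
  rintro ⟨a⟩ ⟨b⟩
  constructor
  · rintro ⟨c, d, hc, hd, hcd⟩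
    refine ⟨φ.symm c, φ.symm d, (Quot.congr φ hrs).injective ?_,
      (Quot.congr φ hrs).injective ?_, by rw [← h]; simpa using hcd⟩
    · exact (congrArg (Quot.mk s) (φ.apply_symm_apply c)).trans hc
    · exact (congrArg (Quot.mk s) (φ.apply_symm_apply d)).trans hd
  · rintro ⟨c, d, hc, hd, hcd⟩
    exact ⟨φ c, φ d, congrArg (Quot.congr φ hrs) hc, congrArg (Quot.congr φ hrs) hd, (h c d).2 hcd⟩

theorem BRel.Iso.cl {Γ Δ : BRel} : Γ.Iso Δ → Γ.Cl.Iso Δ.Cl := by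
  rintro ⟨φ, h⟩
  refine BRel.quotBy_iso φ h fun a b => ?_
  simp only [BRel.lgen, φ.surjective.exists, h]

theorem BRel.Iso.cr {Γ Δ : BRel} : Γ.Iso Δ → Γ.Cr.Iso Δ.Cr := by
  rintro ⟨φ, h⟩
  refine BRel.quotBy_iso φ h fun a b => ?_
  simp only [BRel.rgen, φ.surjective.exists, h]

/-- A quotient of a quotient is a quotient. -/
theorem BRel.quotBy_quotBy_iso (Γ : BRel) {r t : Γ.S → Γ.S → Prop}
    {s : (Γ.quotBy r).S → (Γ.quotBy r).S → Prop}
    (hr : ∀ a b, r a b → Quot.mk t a = Quot.mk t b)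
    (hs : ∀ a b, s (Quot.mk r a) (Quot.mk r b) → Quot.mk t a = Quot.mk t b)
    (ht : ∀ a b, t a b → Quot.mk s (Quot.mk r a) = Quot.mk s (Quot.mk r b)) :
    ((Γ.quotBy r).quotBy s).Iso (Γ.quotBy t) := by
  let f : Quot s → Quot t := Quot.lift (Quot.lift (Quot.mk t) hr) (by
    rintro ⟨a⟩ ⟨b⟩ hab
    exact hs a b hab)
  let g : Quot t → Quot s := Quot.lift (fun a => Quot.mk s (Quot.mk r a)) ht
  have hgf : Function.LeftInverse g f := by rintro ⟨⟨a⟩⟩; rfl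
  have hfg : Function.RightInverse g f := by rintro ⟨a⟩; rfl
  refine ⟨⟨f, g, hgf, hfg⟩, fun x y => ⟨?_, ?_⟩⟩
  · rintro ⟨a, b, ha, hb, hab⟩
    exact ⟨Quot.mk r a, Quot.mk r b, hgf.injective ha, hgf.injective hb, a, b, rfl, rfl, hab⟩
  · rintro ⟨_, _, ha, hb, a, b, rfl, rfl, hab⟩
    exact ⟨a, b, congrArg f ha, congrArg f hb, hab⟩

/-- Successors of equivalent points are equivalent. -/
theorem quot_mk_eq_of_rel {α : Type*} {R : α → α → Prop} {a a' b b' : α}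
    (h : Quot.mk (fun x x' => ∃ y, R x y ∧ R x' y) a = Quot.mk _ a') (hab : R a b)
    (hab' : R a' b') : Quot.mk (fun y y' => ∃ x, R x y ∧ R x y') b = Quot.mk _ b' := by
  let l : α → α → Prop := fun y y' => ∃ x, R x y ∧ R x y'
  let f : α → Set (Quot l) := fun x => {q | ∃ y, R x y ∧ Quot.mk l y = q}
  have hf : ∀ x x', (∃ y, R x y ∧ R x' y) → f x = f x' := by
    rintro x x' ⟨y, hy, hy'⟩
    ext q
    constructor
    · rintro ⟨z, hz, rfl⟩
      exact ⟨y, hy', Quot.sound ⟨x, hy, hz⟩⟩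
    · rintro ⟨z, hz, rfl⟩
      exact ⟨y, hy, Quot.sound ⟨x', hy', hz⟩⟩
  have hfa : f a = f a' := congrArg (Quot.lift f hf) h
  have hb : Quot.mk l b ∈ f a := ⟨b, hab, rfl⟩
  rw [hfa] at hb
  obtain ⟨y, hy, hyb⟩ := hb
  exact hyb.symm.trans (Quot.sound ⟨a', hy, hab'⟩)

theorem quot_mk_eq_of_imp {α : Type*} {r t : α → α → Prop} (h : ∀ a b, r a b → t a b) {a b : α}
    (hab : Quot.mk r a = Quot.mk r b) : Quot.mk t a = Quot.mk t b :=
  congrArg (Quot.map id h) hab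

theorem BRel.cl_cr_iso (Γ : BRel) :
    Γ.Cr.Cl.Iso (Γ.quotBy fun a b => Γ.lgen a b ∨ Γ.rgen a b) := by
  refine Γ.quotBy_quotBy_iso (fun a b h => Quot.sound (Or.inr h)) ?_ ?_
  · rintro a b ⟨_, ⟨c, d, rfl, hd, hcd⟩, c', d', hc', hd', hcd'⟩
    have key : Quot.mk Γ.lgen d = Quot.mk Γ.lgen d' := quot_mk_eq_of_rel hc'.symm hcd hcd'
    exact (quot_mk_eq_of_imp (fun _ _ => Or.inr) hd.symm).trans
      ((quot_mk_eq_of_imp (fun _ _ => Or.inl) key).trans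
        (quot_mk_eq_of_imp (fun _ _ => Or.inr) hd'))
  · rintro a b (⟨x, ha, hb⟩ | h)
    · exact Quot.sound ⟨Quot.mk _ x, ⟨x, a, rfl, rfl, ha⟩, ⟨x, b, rfl, rfl, hb⟩⟩
    · exact congrArg _ (Quot.sound h)

theorem BRel.cr_cl_iso (Γ : BRel) :
    Γ.Cl.Cr.Iso (Γ.quotBy fun a b => Γ.lgen a b ∨ Γ.rgen a b) := by
  refine Γ.quotBy_quotBy_iso (fun a b h => Quot.sound (Or.inl h)) ?_ ?_
  · rintro a b ⟨_, ⟨c, d, hc, rfl, hcd⟩, c', d', hc', hd', hcd'⟩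
    have key : Quot.mk Γ.rgen c = Quot.mk Γ.rgen c' :=
      quot_mk_eq_of_rel (R := flip Γ.R) hd'.symm hcd hcd'
    exact (quot_mk_eq_of_imp (fun _ _ => Or.inl) hc.symm).trans
      ((quot_mk_eq_of_imp (fun _ _ => Or.inr) key).trans
        (quot_mk_eq_of_imp (fun _ _ => Or.inl) hc'))
  · rintro a b (h | ⟨x, ha, hb⟩)
    · exact congrArg _ (Quot.sound h)
    · exact Quot.sound ⟨Quot.mk _ x, ⟨a, x, rfl, rfl, ha⟩, ⟨b, x, rfl, rfl, hb⟩⟩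

theorem BRel.iterate_cl_cr_iso (m : ℕ) (Γ : BRel) :
    (BRel.Cl^[m] Γ.Cr).Iso (BRel.Cl^[m] Γ).Cr := by
  induction m with
  | zero => exact .refl _
  | succ m ih =>
    rw [Function.iterate_succ_apply', Function.iterate_succ_apply']
    exact ih.cl.trans ((cl_cr_iso _).trans (cr_cl_iso _).symm)

theorem BRel.natCard_quotBy_le (Γ : BRel) (r : Γ.S → Γ.S → Prop) :
    Nat.card (Γ.quotBy r).S ≤ Nat.card Γ.S :=
  Nat.card_le_card_of_surjective (Quot.mk r) Quot.mk_surjective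

/-- A quotient with as many vertices as the original relation is isomorphic to it. -/
theorem BRel.quotBy_iso_of_natCard_le (Γ : BRel) (r : Γ.S → Γ.S → Prop)
    (h : Nat.card Γ.S ≤ Nat.card (Γ.quotBy r).S) : (Γ.quotBy r).Iso Γ := by
  have hb : Function.Bijective (Quot.mk r) :=
    (Nat.bijective_iff_surjective_and_card _).2
      ⟨Quot.mk_surjective, le_antisymm h (Γ.natCard_quotBy_le r)⟩
  refine BRel.Iso.symm ⟨Equiv.ofBijective _ hb, fun a b => ⟨?_, fun hab => ⟨a, b, rfl, rfl, hab⟩⟩⟩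
  rintro ⟨c, d, hc, hd, hcd⟩
  rwa [← hb.1 hc, ← hb.1 hd]

theorem BRel.iterate_succ_left (Γ : BRel) (m n : ℕ) :
    BRel.Cl^[m + 1] (BRel.Cr^[n] Γ) = (BRel.Cl^[m] (BRel.Cr^[n] Γ)).Cl :=
  Function.iterate_succ_apply' _ _ _

theorem BRel.iterate_succ_right_iso (Γ : BRel) (m n : ℕ) :
    (BRel.Cl^[m] (BRel.Cr^[n + 1] Γ)).Iso (BRel.Cl^[m] (BRel.Cr^[n] Γ)).Cr := by
  rw [Function.iterate_succ_apply']
  exact BRel.iterate_cl_cr_iso _ _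

theorem BRel.gamma_antitone_left (Γ : BRel) (n : ℕ) : Antitone fun m => Γ.gamma m n :=
  antitone_nat_of_succ_le fun m => by
    simp only [BRel.gamma, BRel.iterate_succ_left]
    exact BRel.natCard_quotBy_le _ _

theorem BRel.gamma_antitone_right (Γ : BRel) (m : ℕ) : Antitone fun n => Γ.gamma m n :=
  antitone_nat_of_succ_le fun n =>
    (Γ.iterate_succ_right_iso m n).natCard_eq.trans_le (BRel.natCard_quotBy_le _ _)

/-- There is an `N` such that for all `m, n ≥ N`,
`C_l^m C_r^n Γ` is graph-isomorphic to `C_l^N C_r^N Γ` (the C-stabilization). -/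
theorem stmt2 (Γ : BRel) : ∃ N, Γ.StabAt N := by
  let f : ℕ × ℕ → ℕ := fun p => Γ.gamma p.1 p.2
  let p := Function.argmin f
  have hp : ∀ m n, Γ.gamma p.1 p.2 ≤ Γ.gamma m n := fun m n => Function.argmin_le f (m, n)
  let N := max p.1 p.2
  have hle : ∀ m n m' n', N ≤ m → N ≤ n → Γ.gamma m n ≤ Γ.gamma m' n' := fun m n m' n' hm hn =>
    ((Γ.gamma_antitone_left n ((le_max_left _ _).trans hm)).trans
      (Γ.gamma_antitone_right p.1 ((le_max_right _ _).trans hn))).trans (hp m' n')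
  have hleft : ∀ m n, N ≤ m → N ≤ n →
      (BRel.Cl^[m + 1] (BRel.Cr^[n] Γ)).Iso (BRel.Cl^[m] (BRel.Cr^[n] Γ)) := by
    intro m n hm hn
    have h := hle m n (m + 1) n hm hn
    simp only [BRel.gamma, BRel.iterate_succ_left] at h
    rw [BRel.iterate_succ_left]
    exact BRel.quotBy_iso_of_natCard_le _ _ h
  have hright : ∀ m n, N ≤ m → N ≤ n →
      (BRel.Cl^[m] (BRel.Cr^[n + 1] Γ)).Iso (BRel.Cl^[m] (BRel.Cr^[n] Γ)) := fun m n hm hn =>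
    (Γ.iterate_succ_right_iso m n).trans <| BRel.quotBy_iso_of_natCard_le _ _ <|
      (hle m n m (n + 1) hm hn).trans_eq (Γ.iterate_succ_right_iso m n).natCard_eq
  refine ⟨N, fun m hm n hn => ?_⟩
  have hm' : (BRel.Cl^[m] (BRel.Cr^[n] Γ)).Iso (BRel.Cl^[N] (BRel.Cr^[n] Γ)) := by
    induction m, hm using Nat.le_induction with
    | base => exact .refl _
    | succ m hm ih => exact (hleft m n hm hn).trans ih
  refine hm'.trans ?_
  clear hm'
  induction n, hn using Nat.le_induction with
  | base => exact .refl _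
  | succ n hn ih => exact (hright N n le_rfl hn).trans ih

end Towber
end

section
/- Let K be a field, let Γ = (R,S) be a finite binary relation, and suppose the K-linearization K(Γ) is isomorphic to a finite direct sum of members of Kronecker's list L(K). Then for every p ≥ 1, the number of summands isomorphic to ^0T^0_{2p} in this decomposition equals γ_{p,p−1}(Γ) − γ_{p,p}(Γ) − γ_{p+1,p−1}(Γ) + γ_{p+1,p}(Γ). -/
open Polynomial

namespace Towber

variable (K : Type) [Field K]

/-! ### Algebraic contractions -/

section Contraction

variable {K}
variable {E V E' V' : Type*} [AddCommGroup E] [Module K E] [AddCommGroup V] [Module K V]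
  [AddCommGroup E'] [Module K E'] [AddCommGroup V'] [Module K V']

/-- The subspace `W + ν(μ⁻¹ W)`. -/
def enlarge (mu nu : E →ₗ[K] V) (W : Submodule K V) : Submodule K V :=
  W ⊔ (W.comap mu).map nu

/-- The subspace of `V` by which one quotients in order to contract `m` times on the left
after contracting `n` times on the right. -/
def collapsed (mu nu : E →ₗ[K] V) (m n : ℕ) : Submodule K V :=
  (enlarge mu nu)^[m] ((enlarge nu mu)^[n] ⊥)

theorem map_enlarge {mu nu : E →ₗ[K] V} {mu' nu' : E' →ₗ[K] V'} (α : E ≃ₗ[K] E')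
    (β : V ≃ₗ[K] V') (hmu : ∀ x, mu' (α x) = β (mu x)) (hnu : ∀ x, nu' (α x) = β (nu x))
    (W : Submodule K V) :
    (enlarge mu nu W).map β.toLinearMap = enlarge mu' nu' (W.map β.toLinearMap) := by
  unfold enlarge
  rw [Submodule.map_sup]
  congr 1
  ext v
  simp only [Submodule.mem_map, Submodule.mem_comap, LinearEquiv.coe_coe]
  constructor
  · rintro ⟨_, ⟨x, hx, rfl⟩, rfl⟩
    exact ⟨α x, ⟨mu x, hx, (hmu x).symm⟩, hnu x⟩
  · rintro ⟨y, ⟨w, hw, hwy⟩, rfl⟩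
    obtain ⟨x, rfl⟩ := α.surjective y
    rw [hmu] at hwy
    obtain rfl := β.injective hwy
    exact ⟨nu x, ⟨x, hw, rfl⟩, (hnu x).symm⟩

theorem map_collapsed {mu nu : E →ₗ[K] V} {mu' nu' : E' →ₗ[K] V'} (α : E ≃ₗ[K] E')
    (β : V ≃ₗ[K] V') (hmu : ∀ x, mu' (α x) = β (mu x)) (hnu : ∀ x, nu' (α x) = β (nu x))
    (m n : ℕ) :
    (collapsed mu nu m n).map β.toLinearMap = collapsed mu' nu' m n := by
  unfold collapsed
  rw [Function.Semiconj.iterate_right (f := Submodule.map β.toLinearMap)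
      (fun W => map_enlarge α β hmu hnu W) m,
    Function.Semiconj.iterate_right (f := Submodule.map β.toLinearMap)
      (fun W => map_enlarge α β hnu hmu W) n, Submodule.map_bot]

theorem enlarge_pi {ι : Type*} [Finite ι] {E V : ι → Type*}
    [∀ i, AddCommGroup (E i)] [∀ i, Module K (E i)]
    [∀ i, AddCommGroup (V i)] [∀ i, Module K (V i)] (mu nu : ∀ i, E i →ₗ[K] V i)
    (W : ∀ i, Submodule K (V i)) :
    enlarge (LinearMap.pi fun i => mu i ∘ₗ LinearMap.proj i)
      (LinearMap.pi fun i => nu i ∘ₗ LinearMap.proj i) (Submodule.pi Set.univ W) =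
      Submodule.pi Set.univ fun i => enlarge (mu i) (nu i) (W i) := by
  unfold enlarge
  ext v
  simp only [Submodule.mem_sup, Submodule.mem_map, Submodule.mem_comap, Submodule.mem_pi,
    Set.mem_univ, true_imp_iff, LinearMap.pi_apply, LinearMap.comp_apply, LinearMap.proj_apply]
  constructor
  · rintro ⟨w, hw, _, ⟨x, hx, rfl⟩, rfl⟩ i
    exact ⟨w i, hw i, nu i (x i), ⟨x i, hx i, rfl⟩, rfl⟩
  · intro h
    choose w hw u hu hwu using h
    choose x hx hxu using hu
    refine ⟨w, hw, u, ⟨x, hx, ?_⟩, funext hwu⟩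
    ext i
    exact hxu i

theorem collapsed_pi {ι : Type*} [Finite ι] {E V : ι → Type*}
    [∀ i, AddCommGroup (E i)] [∀ i, Module K (E i)]
    [∀ i, AddCommGroup (V i)] [∀ i, Module K (V i)] (mu nu : ∀ i, E i →ₗ[K] V i) (m n : ℕ) :
    collapsed (LinearMap.pi fun i => mu i ∘ₗ LinearMap.proj i)
      (LinearMap.pi fun i => nu i ∘ₗ LinearMap.proj i) m n =
      Submodule.pi Set.univ fun i => collapsed (mu i) (nu i) m n := by
  have right (n : ℕ) : (enlarge (LinearMap.pi fun i => nu i ∘ₗ LinearMap.proj i)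
      (LinearMap.pi fun i => mu i ∘ₗ LinearMap.proj i))^[n] ⊥ =
      Submodule.pi Set.univ fun i => (enlarge (nu i) (mu i))^[n] ⊥ := by
    induction n with
    | zero =>
      ext v
      simp [funext_iff]
    | succ n ih => simp only [Function.iterate_succ_apply', ih, enlarge_pi]
  unfold collapsed
  induction m with
  | zero => exact right n
  | succ m ih => simp only [Function.iterate_succ_apply', ih, enlarge_pi]

theorem enlarge_bot_of_injective (mu nu : E →ₗ[K] V) (h : Function.Injective mu) :
    enlarge mu nu ⊥ = ⊥ := by
  simp [enlarge, LinearMap.ker_eq_bot.mpr h]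

/-- If `ν` is injective, right contractions collapse nothing. -/
theorem collapsed_of_injective_right (mu nu : E →ₗ[K] V) (h : Function.Injective nu) (m n : ℕ) :
    collapsed mu nu m n = collapsed mu nu m 0 := by
  unfold collapsed
  rw [Function.iterate_fixed (enlarge_bot_of_injective nu mu h)]
  rfl

/-- If `μ` is bijective, left contractions collapse nothing. -/
theorem collapsed_of_bijective_left (mu nu : E →ₗ[K] V) (h : Function.Bijective mu) (m n : ℕ) :
    collapsed mu nu m n = collapsed mu nu 0 n := by
  unfold collapsed
  refine Function.iterate_fixed ?_ m
  refine sup_eq_left.mpr ?_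
  rw [Submodule.map_le_iff_le_comap]
  induction n with
  | zero => simp [LinearMap.ker_eq_bot.mpr h.1]
  | succ n ih =>
    rw [Function.iterate_succ_apply']
    generalize (enlarge nu mu)^[n] ⊥ = W at ih ⊢
    intro x hx
    obtain ⟨w, hw, _, ⟨z, hz, rfl⟩, hx⟩ := Submodule.mem_sup.mp hx
    obtain ⟨y, rfl⟩ := h.2 w
    rw [← map_add] at hx
    obtain rfl := h.1 hx
    rw [Submodule.mem_comap, map_add]
    exact le_sup_left (a := W) (W.add_mem (ih hw) hz)

end Contraction

/-! ### The dimension invariants -/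

section Codim

variable {K}

/-- The dimension of `V` after `m` left and `n` right contractions. -/
noncomputable def Pair.codim (τ : Pair K) (m n : ℕ) : ℕ :=
  Module.finrank K (τ.V ⧸ collapsed τ.mu τ.nu m n)

theorem Pair.Iso.codim_eq {τ σ : Pair K} (h : Pair.Iso K τ σ) (m n : ℕ) :
    τ.codim m n = σ.codim m n := by
  obtain ⟨α, β, hmu, hnu⟩ := h
  exact (Submodule.Quotient.equiv _ _ β (map_collapsed α β hmu hnu m n)).finrank_eq

theorem codim_dSum {k : ℕ} (τ : Fin k → Pair K) (m n : ℕ) :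
    (dSum K (Fin k) τ).codim m n = ∑ i, (τ i).codim m n := by
  unfold Pair.codim
  rw [← Module.finrank_pi_fintype K, ← (Submodule.quotientPi fun i =>
    collapsed (τ i).mu (τ i).nu m n).finrank_eq]
  exact (Submodule.quotEquivOfEq _ _
    (collapsed_pi (fun i => (τ i).mu) (fun i => (τ i).nu) m n)).finrank_eq

/-- The alternating combination of dimensions that detects the summand `zTz (2 * p)`. -/
noncomputable def Pair.defect (τ : Pair K) (p : ℕ) : ℤ :=
  (τ.codim p (p-1) : ℤ) - τ.codim p p - τ.codim (p+1) (p-1) + τ.codim (p+1) p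

theorem Pair.Iso.defect_eq {τ σ : Pair K} (h : Pair.Iso K τ σ) (p : ℕ) :
    τ.defect p = σ.defect p := by
  simp only [Pair.defect, h.codim_eq]

theorem defect_dSum {k : ℕ} (τ : Fin k → Pair K) (p : ℕ) :
    (dSum K (Fin k) τ).defect p = ∑ i, (τ i).defect p := by
  simp only [Pair.defect, codim_dSum, Nat.cast_sum, Finset.sum_add_distrib,
    Finset.sum_sub_distrib]

theorem defect_of_injective_nu (τ : Pair K) (h : Function.Injective τ.nu) (p : ℕ) :
    τ.defect p = 0 := by
  have key (m n : ℕ) : τ.codim m n = τ.codim m 0 := by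
    unfold Pair.codim
    rw [collapsed_of_injective_right τ.mu τ.nu h m n]
  simp only [Pair.defect, key _ p, key _ (p-1)]
  ring

theorem defect_of_bijective_mu (τ : Pair K) (h : Function.Bijective τ.mu) (p : ℕ) :
    τ.defect p = 0 := by
  have key (m n : ℕ) : τ.codim m n = τ.codim 0 n := by
    unfold Pair.codim
    rw [collapsed_of_bijective_left τ.mu τ.nu h m n]
  simp only [Pair.defect, key p, key (p+1)]
  ring

end Codim

/-! ### Kronecker's list -/

section Kronecker

variable {K}

theorem defect_zT (N p : ℕ) : (zT K N).defect p = 0 := by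
  apply defect_of_injective_nu
  change Function.Injective (Matrix.toLin' (1 : Matrix (Fin N) (Fin N) K))
  rw [Matrix.toLin'_one]
  exact Function.injective_id

theorem defect_Tz (N p : ℕ) : (Tz K N).defect p = 0 := by
  apply defect_of_bijective_mu
  change Function.Bijective (Matrix.toLin' (1 : Matrix (Fin N) (Fin N) K))
  rw [Matrix.toLin'_one]
  exact Function.bijective_id

theorem defect_SP (F : Polynomial K) (hF : F ≠ 0) (p : ℕ) : (SP K F hF).defect p = 0 :=
  defect_of_injective_nu _ Function.injective_id p

theorem defect_Tn (N p : ℕ) : (Tn K N).defect p = 0 := by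
  apply defect_of_injective_nu
  change Function.Injective (Matrix.toLin' (Matrix.of fun (j : Fin (N+1)) (i : Fin N) =>
    if (j : ℕ) = (i : ℕ) + 1 then (1 : K) else 0))
  intro x y hxy
  funext i
  simpa [Matrix.toLin'_apply, Matrix.mulVec, dotProduct, Fin.val_inj] using congrFun hxy i.succ

/-- The vectors of `K^N` vanishing at all coordinates `j` with `n ≤ j < N - m`. -/
def vanishing (K : Type) [Field K] (N m n : ℕ) : Submodule K (Fin N → K) where
  carrier := {v | ∀ j : Fin N, n ≤ (j : ℕ) → (j : ℕ) + m < N → v j = 0}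
  add_mem' hv hw j h1 h2 := by simp [hv j h1 h2, hw j h1 h2]
  zero_mem' _ _ _ := rfl
  smul_mem' c v hv j h1 h2 := by simp [hv j h1 h2]

theorem mem_vanishing {N m n : ℕ} {v : Fin N → K} :
    v ∈ vanishing K N m n ↔ ∀ j : Fin N, n ≤ (j : ℕ) → (j : ℕ) + m < N → v j = 0 :=
  Iff.rfl

theorem zTz_mu (N : ℕ) : (zTz K N).mu = LinearMap.funLeft K K (Fin.castSucc (n := N)) := by
  change Matrix.toLin' (Matrix.of fun (j : Fin N) (i : Fin (N+1)) =>
    if (j : ℕ) = (i : ℕ) then (1 : K) else 0) = _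
  refine LinearMap.ext fun e => funext fun j => ?_
  have : ∀ i : Fin (N+1), ((j : ℕ) = (i : ℕ)) ↔ j.castSucc = i := fun i => by
    simp [Fin.ext_iff]
  simp [Matrix.toLin'_apply, Matrix.mulVec, dotProduct, this, LinearMap.funLeft_apply]

theorem zTz_nu (N : ℕ) : (zTz K N).nu = LinearMap.funLeft K K (Fin.succ (n := N)) := by
  change Matrix.toLin' (Matrix.of fun (j : Fin N) (i : Fin (N+1)) =>
    if (j : ℕ) + 1 = (i : ℕ) then (1 : K) else 0) = _
  refine LinearMap.ext fun e => funext fun j => ?_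
  have : ∀ i : Fin (N+1), ((j : ℕ) + 1 = (i : ℕ)) ↔ j.succ = i := fun i => by
    simp [Fin.ext_iff]
  simp [Matrix.toLin'_apply, Matrix.mulVec, dotProduct, this, LinearMap.funLeft_apply]

theorem enlarge_vanishing_left (N m n : ℕ) :
    enlarge (LinearMap.funLeft K K (Fin.castSucc (n := N))) (LinearMap.funLeft K K (Fin.succ (n := N)))
      (vanishing K N m n) = vanishing K N (m+1) n := by
  apply le_antisymm
  · refine sup_le (fun v hv j h1 h2 => hv j h1 (by omega)) ?_
    rw [Submodule.map_le_iff_le_comap]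
    intro e he
    refine mem_vanishing.mpr fun j h1 h2 => ?_
    have := he ⟨j + 1, by omega⟩ (by simp; omega) (by simp; omega)
    rw [LinearMap.funLeft_apply] at this
    rw [LinearMap.funLeft_apply]
    exact this
  · intro v hv
    by_cases hm : m < N
    · let a : Fin N := ⟨N - m - 1, by omega⟩
      refine Submodule.mem_sup.mpr ⟨v - Pi.single a (v a), ?_, Pi.single a (v a), ?_, by simp⟩
      · refine mem_vanishing.mpr fun j h1 h2 => ?_
        rcases eq_or_ne j a with rfl | hja
        · simp
        · have : (j : ℕ) ≠ N - m - 1 := fun h => hja (Fin.ext h)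
          simp [hja, hv j h1 (by omega)]
      · refine ⟨(Pi.single a.succ (v a) : Fin (N+1) → K), ?_, ?_⟩
        · refine mem_vanishing.mpr fun j h1 h2 => ?_
          rw [LinearMap.funLeft_apply, Pi.single_eq_of_ne]
          intro h
          have := congrArg Fin.val h
          simp [a] at this
          omega
        · funext j
          rw [LinearMap.funLeft_apply]
          simp [Pi.single_apply]
    · exact le_sup_left (a := vanishing K N m n) fun j h1 h2 => by omega

theorem enlarge_vanishing_right (N n : ℕ) :
    enlarge (LinearMap.funLeft K K (Fin.succ (n := N))) (LinearMap.funLeft K K (Fin.castSucc (n := N)))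
      (vanishing K N 0 n) = vanishing K N 0 (n+1) := by
  apply le_antisymm
  · refine sup_le (fun v hv j h1 h2 => hv j (by omega) h2) ?_
    rw [Submodule.map_le_iff_le_comap]
    intro e he
    refine mem_vanishing.mpr fun j h1 h2 => ?_
    have := he ⟨j - 1, by omega⟩ (by simp; omega) (by simp; omega)
    rw [LinearMap.funLeft_apply] at this
    rw [LinearMap.funLeft_apply]
    convert this using 2
    ext
    simp
    omega
  · intro v hv
    by_cases hn : n < N
    · let a : Fin N := ⟨n, hn⟩
      refine Submodule.mem_sup.mpr ⟨v - Pi.single a (v a), ?_, Pi.single a (v a), ?_, by simp⟩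
      · refine mem_vanishing.mpr fun j h1 h2 => ?_
        rcases eq_or_ne j a with rfl | hja
        · simp
        · have : (j : ℕ) ≠ n := fun h => hja (Fin.ext h)
          simp [hja, hv j (by omega) h2]
      · refine ⟨(Pi.single a.castSucc (v a) : Fin (N+1) → K), ?_, ?_⟩
        · refine mem_vanishing.mpr fun j h1 h2 => ?_
          rw [LinearMap.funLeft_apply, Pi.single_eq_of_ne]
          intro h
          have := congrArg Fin.val h
          simp [a] at this
          omega
        · funext j
          rw [LinearMap.funLeft_apply]
          simp [Pi.single_apply]
    · exact le_sup_left (a := vanishing K N 0 n) fun j h1 h2 => by omega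

theorem collapsed_funLeft (N m n : ℕ) :
    collapsed (LinearMap.funLeft K K (Fin.castSucc (n := N))) (LinearMap.funLeft K K (Fin.succ (n := N))) m n =
      vanishing K N m n := by
  unfold collapsed
  induction m with
  | zero =>
    induction n with
    | zero =>
      symm
      refine (Submodule.eq_bot_iff _).mpr fun v hv => ?_
      funext j
      exact hv j (Nat.zero_le _) j.2
    | succ n ih =>
      rw [Function.iterate_zero_apply] at ih
      rw [Function.iterate_zero_apply, Function.iterate_succ_apply', ih, enlarge_vanishing_right]
  | succ m ih => rw [Function.iterate_succ_apply', ih, enlarge_vanishing_left]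

theorem finrank_quotient_vanishing (N m n : ℕ) :
    Module.finrank K ((Fin N → K) ⧸ vanishing K N m n) = N - m - n := by
  let f : (Fin N → K) →ₗ[K] (Fin (N - m - n) → K) :=
    LinearMap.funLeft K K fun i => ⟨i + n, by omega⟩
  have hf : Function.Surjective f := LinearMap.funLeft_surjective_of_injective _ _ _
    fun i j h => Fin.ext (by simpa using h)
  have hker : LinearMap.ker f = vanishing K N m n := by
    ext v
    rw [LinearMap.mem_ker, mem_vanishing]
    constructor
    · intro h j h1 h2
      have := congrFun h ⟨j - n, by omega⟩
      simpa [f, LinearMap.funLeft_apply, Nat.sub_add_cancel h1] using this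
    · intro h
      funext i
      exact h _ (by simp) (by simp; omega)
  rw [← hker, (f.quotKerEquivOfSurjective hf).finrank_eq, Module.finrank_fin_fun]

theorem codim_zTz (N m n : ℕ) : (zTz K N).codim m n = N - m - n := by
  unfold Pair.codim
  have hcollapsed : collapsed (zTz K N).mu (zTz K N).nu m n = vanishing K N m n := by
    rw [zTz_mu, zTz_nu]
    exact collapsed_funLeft N m n
  rw [hcollapsed]
  exact finrank_quotient_vanishing N m n

theorem defect_zTz (N p : ℕ) (hp : 1 ≤ p) :
    (zTz K N).defect p = if N = 2 * p then 1 else 0 := by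
  simp only [Pair.defect, codim_zTz]
  split_ifs <;> omega

open Classical in
theorem IsKron.defect_eq {τ : Pair K} (h : IsKron K τ) (p : ℕ) (hp : 1 ≤ p) :
    τ.defect p = if Pair.Iso K τ (zTz K (2 * p)) then 1 else 0 := by
  split_ifs with hiso
  · rw [hiso.defect_eq, defect_zTz _ _ hp, if_pos rfl]
  · rcases h with ⟨n, -, h⟩ | ⟨n, -, h⟩ | ⟨n, h⟩ | ⟨n, h⟩ | ⟨F, n, -, -, -, -, hF, h⟩
    · rw [h.defect_eq, defect_zT]
    · rw [h.defect_eq, defect_Tz]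
    · rw [h.defect_eq, defect_Tn]
    · rw [h.defect_eq, defect_zTz _ _ hp, if_neg]
      rintro rfl
      exact hiso h
    · rw [h.defect_eq, defect_SP]

end Kronecker

/-! ### Contractions of relations -/

section Relation

variable {K}

/-- Contracting a set-level quotient enlarges the kernel of its linearization. -/
theorem ker_constr_quot {I S S' E V : Type*} [AddCommGroup E] [Module K E] [AddCommGroup V]
    [Module K V] (bE : Module.Basis I K E) (bV : Module.Basis S K V) (src tgt : I → S)
    (mu nu : E →ₗ[K] V) (hmu : ∀ i, mu (bE i) = bV (src i)) (hnu : ∀ i, nu (bE i) = bV (tgt i))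
    (q : S → S') (hq : Function.Surjective q) (r : S' → S' → Prop)
    (hr : ∀ y y', r y y' ↔ ∃ i j, q (src i) = q (src j) ∧ q (tgt i) = y ∧ q (tgt j) = y') :
    LinearMap.ker (bV.constr K fun x => Finsupp.single (Quot.mk r (q x)) (1 : K)) =
      enlarge mu nu (LinearMap.ker (bV.constr K fun x => Finsupp.single (q x) (1 : K))) := by
  classical
  set Q := bV.constr K fun x => Finsupp.single (q x) (1 : K) with hQ
  have hQb (x : S) : Q (bV x) = Finsupp.single (q x) 1 := by simp [hQ, Module.Basis.constr_basis]
  set Q' := bV.constr K fun x => Finsupp.single (Quot.mk r (q x)) (1 : K) with hQ'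
  have hQb' (x : S) : Q' (bV x) = Finsupp.single (Quot.mk r (q x)) 1 := by
    simp [hQ', Module.Basis.constr_basis]
  apply le_antisymm
  · set W := enlarge mu nu (LinearMap.ker Q) with hW
    have hker : ∀ x y, q x = q y → bV x - bV y ∈ LinearMap.ker Q := fun x y h => by
      rw [LinearMap.mem_ker, map_sub, hQb, hQb, h, sub_self]
    have hlift : ∀ y y', r y y' →
        W.mkQ (bV (Function.surjInv hq y)) = W.mkQ (bV (Function.surjInv hq y')) := by
      intro y y' h
      obtain ⟨i, j, hij, rfl, rfl⟩ := (hr y y').mp h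
      have h1 (x : S) : W.mkQ (bV (Function.surjInv hq (q x))) = W.mkQ (bV x) :=
        (Submodule.Quotient.eq W).mpr
          (le_sup_left (a := LinearMap.ker Q) (hker _ _ (Function.surjInv_eq hq (q x))))
      rw [h1, h1]
      refine (Submodule.Quotient.eq W).mpr (le_sup_right (a := LinearMap.ker Q) ?_)
      refine ⟨bE i - bE j, ?_, by rw [map_sub, hnu, hnu]⟩
      change mu (bE i - bE j) ∈ LinearMap.ker Q
      rw [map_sub, hmu, hmu]
      exact hker _ _ hij
    let H : (Quot r →₀ K) →ₗ[K] V ⧸ W := Finsupp.linearCombination K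
      (Quot.lift (fun y => W.mkQ (bV (Function.surjInv hq y))) hlift)
    have hH : H ∘ₗ Q' = W.mkQ := bV.ext fun x => by
      rw [LinearMap.comp_apply, hQb', Finsupp.linearCombination_single, one_smul]
      exact (Submodule.Quotient.eq W).mpr
        (le_sup_left (a := LinearMap.ker Q) (hker _ _ (Function.surjInv_eq hq (q x))))
    calc LinearMap.ker Q' ≤ LinearMap.ker (H ∘ₗ Q') := LinearMap.ker_le_ker_comp _ _
      _ = W := by rw [hH, Submodule.ker_mkQ]
  · refine sup_le ?_ ?_
    · have : Q' = Finsupp.lmapDomain K K (Quot.mk r) ∘ₗ Q := bV.ext fun x => by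
        rw [LinearMap.comp_apply, hQb', hQb, Finsupp.lmapDomain_apply, Finsupp.mapDomain_single]
      rw [this]
      exact LinearMap.ker_le_ker_comp _ _
    · let G : (S' →₀ K) →ₗ[K] (Quot r →₀ K) := Finsupp.linearCombination K fun s =>
        if h : ∃ i, q (src i) = s then Finsupp.single (Quot.mk r (q (tgt h.choose))) 1 else 0
      have hG : Q' ∘ₗ nu = G ∘ₗ Q ∘ₗ mu := bE.ext fun i => by
        have h : ∃ j, q (src j) = q (src i) := ⟨i, rfl⟩
        simp only [LinearMap.comp_apply, hmu, hnu, hQb, hQb', G,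
          Finsupp.linearCombination_single, one_smul, dif_pos h]
        congr 1
        exact Quot.sound ((hr _ _).mpr ⟨i, h.choose, h.choose_spec.symm, rfl, rfl⟩)
      rw [Submodule.map_le_iff_le_comap]
      intro e he
      change Q' (nu e) = 0
      have : Q (mu e) = 0 := he
      rw [← LinearMap.comp_apply, hG, LinearMap.comp_apply, LinearMap.comp_apply, this, map_zero]

theorem toLin'_incidence_basisFun {I S : Type*} [Fintype I] [DecidableEq I] [Fintype S]
    [DecidableEq S] (f : I → S) (e : I) :
    Matrix.toLin' (Matrix.of fun (v : S) (e : I) => if f e = v then (1 : K) else 0)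
      (Pi.basisFun K I e) = Pi.basisFun K S (f e) := by
  funext v
  simp [Pi.single_apply, eq_comm]

theorem linz_bases (Γ : BRel) :
    ∃ (bE : Module.Basis {p : Γ.S × Γ.S // Γ.R p.1 p.2} K (Γ.linz K).E)
      (bV : Module.Basis Γ.S K (Γ.linz K).V),
      (∀ e, (Γ.linz K).mu (bE e) = bV e.1.1) ∧ (∀ e, (Γ.linz K).nu (bE e) = bV e.1.2) := by
  classical
  let := Fintype.ofFinite Γ.S
  exact ⟨Pi.basisFun K {p : Γ.S × Γ.S // Γ.R p.1 p.2}, Pi.basisFun K Γ.S,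
    @toLin'_incidence_basisFun K _ {p : Γ.S × Γ.S // Γ.R p.1 p.2} Γ.S _ _ _ _ fun e => e.1.1,
    @toLin'_incidence_basisFun K _ {p : Γ.S × Γ.S // Γ.R p.1 p.2} Γ.S _ _ _ _ fun e => e.1.2⟩

/-- `Δ` is the quotient of `Γ` by a map whose linearization has kernel `W`. -/
def IsQuotient (Γ Δ : BRel) {V : Type} [AddCommGroup V] [Module K V]
    (bV : Module.Basis Γ.S K V) (W : Submodule K V) : Prop :=
  ∃ q : Γ.S → Δ.S, Function.Surjective q ∧
    (∀ a b, Δ.R a b ↔ ∃ x y, q x = a ∧ q y = b ∧ Γ.R x y) ∧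
    LinearMap.ker (bV.constr K fun x => Finsupp.single (q x) (1 : K)) = W

variable {Γ Δ : BRel} {E V : Type} [AddCommGroup E] [Module K E] [AddCommGroup V] [Module K V]
  {bE : Module.Basis {p : Γ.S × Γ.S // Γ.R p.1 p.2} K E} {bV : Module.Basis Γ.S K V}
  {mu nu : E →ₗ[K] V} {W : Submodule K V}

theorem quotBy_relation {q : Γ.S → Δ.S} (hR : ∀ a b, Δ.R a b ↔ ∃ x y, q x = a ∧ q y = b ∧ Γ.R x y)
    (r : Δ.S → Δ.S → Prop) (a b : Quot r) :
    (Δ.quotBy r).R a b ↔ ∃ x y, Quot.mk r (q x) = a ∧ Quot.mk r (q y) = b ∧ Γ.R x y := by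
  constructor
  · rintro ⟨_, _, rfl, rfl, h⟩
    obtain ⟨x, y, rfl, rfl, hxy⟩ := (hR _ _).mp h
    exact ⟨x, y, rfl, rfl, hxy⟩
  · rintro ⟨x, y, rfl, rfl, h⟩
    exact ⟨_, _, rfl, rfl, (hR _ _).mpr ⟨x, y, rfl, rfl, h⟩⟩

theorem IsQuotient.cl (h : IsQuotient Γ Δ bV W) (hmu : ∀ e, mu (bE e) = bV e.1.1)
    (hnu : ∀ e, nu (bE e) = bV e.1.2) : IsQuotient Γ Δ.Cl bV (enlarge mu nu W) := by
  obtain ⟨q, hq, hR, rfl⟩ := h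
  refine ⟨fun x => Quot.mk _ (q x), Quot.mk_surjective.comp hq, quotBy_relation hR _, ?_⟩
  refine ker_constr_quot bE bV _ _ mu nu hmu hnu q hq Δ.lgen fun y y' => ?_
  constructor
  · rintro ⟨x, h1, h2⟩
    obtain ⟨x1, y1, rfl, rfl, hxy1⟩ := (hR _ _).mp h1
    obtain ⟨x2, y2, hx, rfl, hxy2⟩ := (hR _ _).mp h2
    exact ⟨⟨(x1, y1), hxy1⟩, ⟨(x2, y2), hxy2⟩, hx.symm, rfl, rfl⟩
  · rintro ⟨⟨⟨x1, y1⟩, h1⟩, ⟨⟨x2, y2⟩, h2⟩, hx, rfl, rfl⟩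
    exact ⟨q x1, (hR _ _).mpr ⟨x1, y1, rfl, rfl, h1⟩, (hR _ _).mpr ⟨x2, y2, hx.symm, rfl, h2⟩⟩

theorem IsQuotient.cr (h : IsQuotient Γ Δ bV W) (hmu : ∀ e, mu (bE e) = bV e.1.1)
    (hnu : ∀ e, nu (bE e) = bV e.1.2) : IsQuotient Γ Δ.Cr bV (enlarge nu mu W) := by
  obtain ⟨q, hq, hR, rfl⟩ := h
  refine ⟨fun x => Quot.mk _ (q x), Quot.mk_surjective.comp hq, quotBy_relation hR _, ?_⟩
  refine ker_constr_quot bE bV _ _ nu mu hnu hmu q hq Δ.rgen fun x x' => ?_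
  constructor
  · rintro ⟨y, h1, h2⟩
    obtain ⟨x1, y1, rfl, rfl, hxy1⟩ := (hR _ _).mp h1
    obtain ⟨x2, y2, rfl, hy, hxy2⟩ := (hR _ _).mp h2
    exact ⟨⟨(x1, y1), hxy1⟩, ⟨(x2, y2), hxy2⟩, hy.symm, rfl, rfl⟩
  · rintro ⟨⟨⟨x1, y1⟩, h1⟩, ⟨⟨x2, y2⟩, h2⟩, hy, rfl, rfl⟩
    exact ⟨q y1, (hR _ _).mpr ⟨x1, y1, rfl, rfl, h1⟩, (hR _ _).mpr ⟨x2, y2, rfl, hy.symm, h2⟩⟩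

theorem isQuotient_refl (bV : Module.Basis Γ.S K V) : IsQuotient Γ Γ bV ⊥ := by
  refine ⟨id, Function.surjective_id, fun a b => by simp, ?_⟩
  have : (bV.constr K fun x => Finsupp.single (id x) (1 : K)) = bV.repr.toLinearMap :=
    bV.ext fun x => by simp [Module.Basis.constr_basis]
  rw [this]
  exact bV.repr.ker

theorem isQuotient_iterate (hmu : ∀ e, mu (bE e) = bV e.1.1) (hnu : ∀ e, nu (bE e) = bV e.1.2)
    (m n : ℕ) : IsQuotient Γ (BRel.Cl^[m] (BRel.Cr^[n] Γ)) bV (collapsed mu nu m n) := by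
  unfold collapsed
  induction m with
  | zero =>
    simp only [Function.iterate_zero_apply]
    induction n with
    | zero => exact isQuotient_refl bV
    | succ n ih =>
      simp only [Function.iterate_succ_apply']
      exact ih.cr hmu hnu
  | succ m ih =>
    simp only [Function.iterate_succ_apply'] at ih ⊢
    exact ih.cl hmu hnu

theorem IsQuotient.card_eq (h : IsQuotient Γ Δ bV W) : Nat.card Δ.S = Module.finrank K (V ⧸ W) := by
  obtain ⟨q, hq, -, rfl⟩ := h
  have hsurj : Function.Surjective (bV.constr K fun x => Finsupp.single (q x) (1 : K)) := by
    rw [← LinearMap.range_eq_top, Module.Basis.constr_range, eq_top_iff,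
      ← (Finsupp.basisSingleOne (R := K) (ι := Δ.S)).span_eq]
    refine Submodule.span_mono ?_
    rintro _ ⟨s, rfl⟩
    obtain ⟨x, rfl⟩ := hq s
    exact ⟨x, by simp⟩
  rw [(LinearMap.quotKerEquivOfSurjective _ hsurj).finrank_eq,
    Module.finrank_eq_nat_card_basis (Finsupp.basisSingleOne (R := K) (ι := Δ.S))]

theorem gamma_eq_codim (Γ : BRel) (m n : ℕ) : Γ.gamma m n = (Γ.linz K).codim m n := by
  obtain ⟨bE, bV, hmu, hnu⟩ := linz_bases (K := K) Γ
  exact (isQuotient_iterate hmu hnu m n).card_eq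

end Relation

/-- The multiplicity of `^0T^0_{2p}` (`p ≥ 1`) in a Kronecker
decomposition of `K(Γ)` is `γ_{p,p−1} − γ_{p,p} − γ_{p+1,p−1} + γ_{p+1,p}`. -/
theorem stmt7 (K : Type) [Field K] (Γ : BRel) (k : ℕ) (τ : Fin k → Pair K)
    (hτ : ∀ i, IsKron K (τ i)) (h : Pair.Iso K (Γ.linz K) (dSum K (Fin k) τ))
    (p : ℕ) (hp : 1 ≤ p) :
    (Nat.card {i : Fin k // Pair.Iso K (τ i) (zTz K (2*p))} : ℤ) =
      (Γ.gamma p (p-1) : ℤ) - (Γ.gamma p p : ℤ)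
        - (Γ.gamma (p+1) (p-1) : ℤ) + (Γ.gamma (p+1) p : ℤ) := by
  classical
  simp only [gamma_eq_codim (K := K) Γ]
  change _ = (Γ.linz K).defect p
  rw [h.defect_eq, defect_dSum, Finset.sum_congr rfl fun i _ => (hτ i).defect_eq p hp,
    Finset.sum_boole, Nat.card_eq_fintype_card, Fintype.card_subtype]

end Towber
end
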